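/- For each i ≥ 6, let α_i = a if i is even and α_i = b if i is odd, and let flip(α_i) denote the other letter. Then the set of minimal unique substrings of the Fibonacci word F_i is exactly MUS(F_i) = { α_i · G_{i−3} · α_i , flip(α_i) · G_{i−2} · flip(α_i) }, where G_k denotes F_k with its last two letters removed. -/

import Mathlib

/-- Extension of a letter map `φ` to a morphism on words. -/
def wlift {α β : Type*} (φ : α → List β) (u : List α) : List β := (u.map φ).flatten

/-- Set of starting positions (0-indexed) of occurrences of `u` in `w`. -/
def Occ {β : Type*} (u w : List β) : Set ℕ := {i | i ≤ w.length ∧ u <+: w.drop i}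

/-- Number of occurrences of `u` as a factor of `w`. -/
noncomputable def occ {β : Type*} (u w : List β) : ℕ := (Occ u w).ncard

/-- The binary alphabet. -/
inductive Ltr : Type
  | a : Ltr
  | b : Ltr

/-- The Fibonacci morphism: a ↦ ab, b ↦ a. -/
def fib : Ltr → List Ltr
  | Ltr.a => [Ltr.a, Ltr.b]
  | Ltr.b => [Ltr.a]

/-- The Fibonacci word of order `i`: `F i = φ^{i-1}(b)`. -/
def F (i : ℕ) : List Ltr := (wlift fib)^[i - 1] [Ltr.b]

/-- Exchange the letters a and b. -/
def flipLetter : Ltr → Ltr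
  | Ltr.a => Ltr.b
  | Ltr.b => Ltr.a

/-- `G i` is the Fibonacci word `F i` with its last two letters removed. -/
def G (i : ℕ) : List Ltr := (F i).dropLast.dropLast

/-- `u` is a minimal unique substring of `w`. -/
def IsMUS {β : Type*} (u w : List β) : Prop :=
  occ u w = 1 ∧ 2 ≤ occ u.tail w ∧ 2 ≤ occ u.dropLast w

/-- `α_i` is `a` if `i` is even and `b` if `i` is odd. -/
def alph (i : ℕ) : Ltr := if i % 2 = 0 then Ltr.a else Ltr.b

theorem mem_Occ_iff {β : Type*} {u w : List β} {i : ℕ} :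
    i ∈ Occ u w ↔ i + u.length ≤ w.length ∧ ∀ k < u.length, w[i + k]? = u[k]? := by
  constructor
  · rintro ⟨hi, t, ht⟩
    have hl := congrArg List.length ht
    simp only [List.length_append, List.length_drop] at hl
    refine ⟨by omega, fun k hk => ?_⟩
    rw [← List.getElem?_drop, ← ht, List.getElem?_append_left hk]
  · rintro ⟨hi, h⟩
    refine ⟨by omega, ?_⟩
    rw [List.prefix_iff_getElem?]
    intro k hk
    rw [List.getElem?_drop, h k hk, List.getElem?_eq_getElem hk]

theorem mem_Occ_iff_exists_append {β : Type*} {u w : List β} {i : ℕ} :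
    i ∈ Occ u w ↔ ∃ p s, w = p ++ u ++ s ∧ p.length = i := by
  constructor
  · rintro ⟨hi, t, ht⟩
    refine ⟨w.take i, t, ?_, by simpa using hi⟩
    rw [List.append_assoc, ht, List.take_append_drop]
  · rintro ⟨p, s, rfl, rfl⟩
    exact ⟨by simp, by simp⟩

theorem finite_Occ {β : Type*} (u w : List β) : (Occ u w).Finite :=
  (Set.finite_Iic w.length).subset fun _ h => h.1

theorem two_le_occ_iff {β : Type*} {u w : List β} :
    2 ≤ occ u w ↔ ∃ s ∈ Occ u w, ∃ t ∈ Occ u w, s ≠ t :=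
  Set.one_lt_ncard_iff (finite_Occ u w) |>.trans (by grind)

theorem occ_eq_one_iff {β : Type*} {u w : List β} :
    occ u w = 1 ↔ (∃ s, s ∈ Occ u w) ∧ (Occ u w).Subsingleton := by
  rw [occ, Set.ncard_eq_one]
  constructor
  · rintro ⟨s, hs⟩
    simp [hs]
  · rintro ⟨⟨s, hs⟩, h⟩
    exact ⟨s, h.eq_singleton_of_mem hs⟩

theorem add_mem_Occ {β : Type*} {m v w : List β} {d t : ℕ}
    (hm : d ∈ Occ m v) (hv : t ∈ Occ v w) : t + d ∈ Occ m w := by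
  rw [mem_Occ_iff] at hm hv ⊢
  refine ⟨by omega, fun k hk => ?_⟩
  rw [← hm.2 k hk, ← hv.2 (d + k) (by omega), add_assoc]

/-- A factor of a factor, in terms of absolute positions. -/
theorem sub_mem_Occ {β : Type*} {m v w : List β} {d s : ℕ} (hm : d ∈ Occ m w)
    (hv : s ∈ Occ v w) (hsd : s ≤ d) (hl : d + m.length ≤ s + v.length) :
    d - s ∈ Occ m v := by
  rw [mem_Occ_iff] at hm hv ⊢
  refine ⟨by omega, fun k hk => ?_⟩
  rw [← hm.2 k hk, ← hv.2 (d - s + k) (by omega)]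
  congr 1
  omega

theorem tail_mem_Occ {β : Type*} {u w : List β} {s : ℕ} (hu : s ∈ Occ u w) (h : u ≠ []) :
    s + 1 ∈ Occ u.tail w := by
  obtain _ | ⟨x, u⟩ := u
  · exact absurd rfl h
  · exact add_mem_Occ (mem_Occ_iff_exists_append.2 ⟨[x], [], by simp, rfl⟩) hu

theorem dropLast_mem_Occ {β : Type*} {u w : List β} {s : ℕ} (hu : s ∈ Occ u w) :
    s ∈ Occ u.dropLast w :=
  ⟨hu.1, (List.dropLast_prefix u).trans hu.2⟩

theorem eq_of_mem_Occ {β : Type*} {u v w : List β} {s : ℕ} (hu : s ∈ Occ u w)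
    (hv : s ∈ Occ v w) (hl : u.length = v.length) : u = v :=
  (List.prefix_of_prefix_length_le hu.2 hv.2 hl.le).eq_of_length hl

/-- A minimal unique substring covering an occurrence of a unique factor equals that factor. -/
theorem IsMUS.eq_of_covers {β : Type*} {u m w : List β} (hu : IsMUS u w) {s d : ℕ}
    (hs : s ∈ Occ u w) (hd : d ∈ Occ m w) (hm : (Occ m w).Subsingleton) (hsd : s ≤ d)
    (hl : d + m.length ≤ s + u.length) (hpos : 0 < m.length) : u = m := by
  have hne : u ≠ [] := by rintro rfl; simp at hl; omega
  obtain ⟨-, h2, h3⟩ := hu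
  obtain ⟨t, ht, t', ht', htt⟩ := two_le_occ_iff.1 h2
  obtain ⟨r, hr, r', hr', hrr⟩ := two_le_occ_iff.1 h3
  rcases Nat.lt_or_ge s d with h | h
  · have := sub_mem_Occ hd (tail_mem_Occ hs hne) h (by simp; omega)
    have := hm (add_mem_Occ this ht) (add_mem_Occ this ht')
    omega
  · rcases Nat.lt_or_ge (d + m.length) (s + u.length) with h' | h'
    · have := sub_mem_Occ hd (dropLast_mem_Occ hs) hsd (by simp; omega)
      have := hm (add_mem_Occ this hr) (add_mem_Occ this hr')
      omega
    · obtain rfl : s = d := by omega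
      exact eq_of_mem_Occ hs hd (by omega)

/-- Transport of occurrences along a partial period. -/
theorem shift_mem_Occ {β : Type*} {u w : List β} {s t : ℕ} (hs : s ∈ Occ u w)
    (ht : t + u.length ≤ w.length) (h : ∀ k < u.length, w[t + k]? = w[s + k]?) :
    t ∈ Occ u w := by
  rw [mem_Occ_iff] at hs ⊢
  exact ⟨ht, fun k hk => (h k hk).trans (hs.2 k hk)⟩

/-- A word of length `f + g` with period `g`, and with period `f` up to its last two letters,
has exactly two minimal unique substrings as soon as the two factors straddling the
corresponding repetitions are unique. -/
theorem setOf_isMUS_eq_pair {β : Type*} {w m₁ m₂ : List β} {f g : ℕ} (hf : 1 ≤ f) (hfg : f < g)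
    (hw : w.length = f + g) (hpf : ∀ j, j + 2 < g → w[j]? = w[j + f]?)
    (hpg : ∀ j < f, w[j]? = w[j + g]?)
    (hm₁ : f - 1 ∈ Occ m₁ w) (hl₁ : m₁.length = g - f) (hu₁ : (Occ m₁ w).Subsingleton)
    (hm₂ : g - 1 ∈ Occ m₂ w) (hl₂ : m₂.length = f) (hu₂ : (Occ m₂ w).Subsingleton) :
    {u | IsMUS u w} = {m₁, m₂} := by
  have up : ∀ {u : List β} {s}, s ∈ Occ u w → s + u.length + 2 ≤ g → s + f ∈ Occ u w := by
    intro u s hs h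
    refine shift_mem_Occ hs (by omega) fun k hk => ?_
    rw [hpf (s + k) (by omega), Nat.add_right_comm]
  have down : ∀ {u : List β} {s}, s ∈ Occ u w → f ≤ s → s + u.length + 2 ≤ f + g →
      s - f ∈ Occ u w := by
    intro u s hs h h'
    refine shift_mem_Occ hs (by omega) fun k hk => ?_
    rw [hpf (s - f + k) (by omega)]
    congr 1
    omega
  have down' : ∀ {u : List β} {s}, s ∈ Occ u w → g ≤ s → s - g ∈ Occ u w := by
    intro u s hs h
    have := (mem_Occ_iff.1 hs).1
    refine shift_mem_Occ hs (by omega) fun k hk => ?_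
    rw [hpg (s - g + k) (by omega)]
    congr 1
    omega
  ext u
  simp only [Set.mem_ofPred_eq, Set.mem_insert_iff, Set.mem_singleton_iff]
  constructor
  · intro hu
    obtain ⟨⟨s, hs⟩, hsub⟩ := occ_eq_one_iff.1 hu.1
    have hlen := (mem_Occ_iff.1 hs).1
    by_cases h1 : s + u.length + 2 ≤ g
    · have := hsub hs (up hs h1)
      omega
    by_cases h2 : s + 1 ≤ f
    · exact .inl (hu.eq_of_covers hs hm₁ hu₁ (by omega) (by omega) (by omega))
    by_cases h3 : s + u.length + 2 ≤ f + g
    · have := hsub hs (down hs (by omega) h3)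
      omega
    by_cases h4 : s + 1 ≤ g
    · exact .inr (hu.eq_of_covers hs hm₂ hu₂ (by omega) (by omega) (by omega))
    · have := hsub hs (down' hs (by omega))
      omega
  · have ne₁ : m₁ ≠ [] := by rintro rfl; simp at hl₁; omega
    have ne₂ : m₂ ≠ [] := by rintro rfl; simp at hl₂; omega
    rintro (rfl | rfl)
    · refine ⟨occ_eq_one_iff.2 ⟨⟨_, hm₁⟩, hu₁⟩, two_le_occ_iff.2 ?_, two_le_occ_iff.2 ?_⟩
      · have h := tail_mem_Occ hm₁ ne₁
        exact ⟨_, h, _, down h (by omega) (by simp; omega), by omega⟩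
      · have h := dropLast_mem_Occ hm₁
        exact ⟨_, h, _, up h (by simp; omega), by omega⟩
    · refine ⟨occ_eq_one_iff.2 ⟨⟨_, hm₂⟩, hu₂⟩, two_le_occ_iff.2 ?_, two_le_occ_iff.2 ?_⟩
      · have h := tail_mem_Occ hm₂ ne₂
        exact ⟨_, h, _, down' h (by omega), by omega⟩
      · have h := dropLast_mem_Occ hm₂
        exact ⟨_, h, _, down h (by omega) (by simp; omega), by omega⟩

@[simp] theorem wlift_fib_nil : wlift fib [] = [] := rfl

@[simp] theorem wlift_fib_cons_a (w : List Ltr) :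
    wlift fib (Ltr.a :: w) = Ltr.a :: Ltr.b :: wlift fib w := rfl

@[simp] theorem wlift_fib_cons_b (w : List Ltr) :
    wlift fib (Ltr.b :: w) = Ltr.a :: wlift fib w := rfl

@[simp] theorem wlift_append {α β : Type*} (φ : α → List β) (u v : List α) :
    wlift φ (u ++ v) = wlift φ u ++ wlift φ v := by
  simp [wlift]

theorem wlift_fib_ne_b_cons (w t : List Ltr) : wlift fib w ≠ Ltr.b :: t := by
  rcases w with _ | ⟨_ | _, w⟩ <;> simp

theorem wlift_fib_injective : Function.Injective (wlift fib) := by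
  intro u
  induction u with
  | nil => rintro (_ | ⟨_ | _, v⟩) h <;> simp_all
  | cons x u ih =>
    rintro (_ | ⟨y, v⟩) h
    · cases x <;> simp at h
    · cases x <;> cases y <;> simp at h
      · rw [ih h]
      · exact absurd h.symm (wlift_fib_ne_b_cons _ _)
      · exact absurd h (wlift_fib_ne_b_cons _ _)
      · rw [ih h]

/-- Every `a` in `φ(w)` starts the image of a letter. -/
theorem exists_cut_of_wlift_fib_eq {w x y : List Ltr} (h : wlift fib w = x ++ Ltr.a :: y) :
    ∃ w₁ w₂, w = w₁ ++ w₂ ∧ wlift fib w₁ = x ∧ wlift fib w₂ = Ltr.a :: y := by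
  induction w generalizing x with
  | nil => simp at h
  | cons c w ih =>
    rcases x with _ | ⟨d, x⟩
    · exact ⟨[], c :: w, rfl, rfl, h⟩
    · cases c
      · rcases x with _ | ⟨e, x⟩
        · simp at h
        · simp only [wlift_fib_cons_a, List.cons_append, List.cons.injEq] at h
          obtain ⟨rfl, rfl, h⟩ := h
          obtain ⟨w₁, w₂, rfl, rfl, h₂⟩ := ih h
          exact ⟨Ltr.a :: w₁, w₂, rfl, rfl, h₂⟩
      · simp only [wlift_fib_cons_b, List.cons_append, List.cons.injEq] at h
        obtain ⟨rfl, h⟩ := h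
        obtain ⟨w₁, w₂, rfl, rfl, h₂⟩ := ih h
        exact ⟨Ltr.b :: w₁, w₂, rfl, rfl, h₂⟩

/-- Every `b` in `φ(w)` is preceded by an `a`. -/
theorem exists_eq_append_a_of_wlift_fib_eq {w x y : List Ltr}
    (h : wlift fib w = x ++ Ltr.b :: y) : ∃ z, x = z ++ [Ltr.a] := by
  induction w generalizing x with
  | nil => simp at h
  | cons c w ih =>
    cases c
    · rcases x with _ | ⟨d, _ | ⟨e, x⟩⟩
      · simp at h
      · simp at h
        exact ⟨[], by simp [h.1]⟩
      · simp only [wlift_fib_cons_a, List.cons_append, List.cons.injEq] at h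
        obtain ⟨z, rfl⟩ := ih h.2.2
        exact ⟨d :: e :: z, rfl⟩
    · rcases x with _ | ⟨d, x⟩
      · simp at h
      · simp only [wlift_fib_cons_b, List.cons_append, List.cons.injEq] at h
        obtain ⟨z, rfl⟩ := ih h.2
        exact ⟨d :: z, rfl⟩

theorem exists_append_of_wlift_fib_eq {w v y : List Ltr}
    (h : wlift fib w = wlift fib v ++ Ltr.a :: y) :
    ∃ w', w = v ++ w' ∧ wlift fib w' = Ltr.a :: y := by
  obtain ⟨w₁, w₂, rfl, h₁, h₂⟩ := exists_cut_of_wlift_fib_eq h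
  exact ⟨w₂, by rw [wlift_fib_injective h₁], h₂⟩

theorem desubstitute_b {w v p s : List Ltr}
    (h : wlift fib w = p ++ ([Ltr.b] ++ (wlift fib v ++ [Ltr.a]) ++ [Ltr.b]) ++ s) :
    ∃ q t, w = q ++ ([Ltr.a] ++ v ++ [Ltr.a]) ++ t ∧ p = wlift fib q ++ [Ltr.a] := by
  obtain ⟨z, rfl⟩ := exists_eq_append_a_of_wlift_fib_eq
    (y := wlift fib v ++ Ltr.a :: Ltr.b :: s) (by simpa using h)
  obtain ⟨q, w₂, rfl, rfl, h₂⟩ := exists_cut_of_wlift_fib_eq (x := z)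
    (y := Ltr.b :: (wlift fib v ++ Ltr.a :: Ltr.b :: s)) (by simpa using h)
  obtain ⟨w₃, rfl, h₃⟩ := exists_append_of_wlift_fib_eq (v := Ltr.a :: v)
    (y := Ltr.b :: s) (by simpa using h₂)
  rcases w₃ with _ | ⟨_ | _, t⟩
  · simp at h₃
  · exact ⟨q, t, by simp, rfl⟩
  · simp at h₃
    exact absurd h₃ (wlift_fib_ne_b_cons _ _)

theorem desubstitute_a {w v p s : List Ltr}
    (h : wlift fib w = p ++ ([Ltr.a] ++ (wlift fib v ++ [Ltr.a]) ++ [Ltr.a]) ++ s) :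
    ∃ q t, w = q ++ ([Ltr.b] ++ v ++ [Ltr.b]) ++ t ∧ p = wlift fib q := by
  obtain ⟨q, w₂, rfl, rfl, h₂⟩ := exists_cut_of_wlift_fib_eq (x := p)
    (y := wlift fib v ++ Ltr.a :: Ltr.a :: s) (by simpa using h)
  obtain ⟨w₃, rfl, h₃⟩ := exists_append_of_wlift_fib_eq (v := Ltr.b :: v)
    (y := Ltr.a :: s) (by simpa using h₂)
  rcases w₃ with _ | ⟨_ | _, t⟩
  · simp at h₃
  · simp at h₃
  · exact ⟨q, t, by simp, rfl⟩

theorem subsingleton_Occ_wlift_fib {c : Ltr} {v w : List Ltr}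
    (h : (Occ ([c] ++ v ++ [c]) w).Subsingleton) :
    (Occ ([flipLetter c] ++ (wlift fib v ++ [Ltr.a]) ++ [flipLetter c])
      (wlift fib w)).Subsingleton := by
  have key : ∀ q t q' t', w = q ++ ([c] ++ v ++ [c]) ++ t → w = q' ++ ([c] ++ v ++ [c]) ++ t' →
      q = q' := by
    intro q t q' t' h₁ h₂
    have hl := h (mem_Occ_iff_exists_append.2 ⟨q, t, h₁, rfl⟩)
      (mem_Occ_iff_exists_append.2 ⟨q', t', h₂, rfl⟩)
    rw [h₁, List.append_assoc, List.append_assoc q'] at h₂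
    exact List.append_inj_left h₂ hl
  intro i hi j hj
  obtain ⟨p, s, hp, rfl⟩ := mem_Occ_iff_exists_append.1 hi
  obtain ⟨p', s', hp', rfl⟩ := mem_Occ_iff_exists_append.1 hj
  cases c
  · obtain ⟨q, t, hq, rfl⟩ := desubstitute_b hp
    obtain ⟨q', t', hq', rfl⟩ := desubstitute_b hp'
    rw [key _ _ _ _ hq hq']
  · obtain ⟨q, t, hq, rfl⟩ := desubstitute_a hp
    obtain ⟨q', t', hq', rfl⟩ := desubstitute_a hp'
    rw [key _ _ _ _ hq hq']

@[simp] theorem flipLetter_flipLetter (c : Ltr) : flipLetter (flipLetter c) = c := by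
  cases c <;> rfl

theorem alph_succ (k : ℕ) : alph (k + 1) = flipLetter (alph k) := by
  rcases Nat.mod_two_eq_zero_or_one k with h | h <;> simp [alph, h, Nat.add_mod, flipLetter]

theorem F_succ (k : ℕ) : F (k + 2) = wlift fib (F (k + 1)) := by
  simp [F, Function.iterate_succ_apply']

theorem F_add_three (k : ℕ) : F (k + 3) = F (k + 2) ++ F (k + 1) := by
  induction k with
  | zero => rfl
  | succ k ih =>
    rw [F_succ (k + 2), ih, wlift_append, ← F_succ (k + 1), ← F_succ k, ← ih]

theorem F_eq_G_append (k : ℕ) :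
    F (k + 3) = G (k + 3) ++ [flipLetter (alph (k + 3)), alph (k + 3)] ∧
      G (k + 4) = wlift fib (G (k + 3)) ++ [Ltr.a] := by
  have hG : ∀ n u x y, F n = u ++ [x, y] → G n = u := by
    intro n u x y h
    rw [G, h]
    simp [List.dropLast_append_of_ne_nil]
  have step : ∀ k, F (k + 3) = G (k + 3) ++ [flipLetter (alph (k + 3)), alph (k + 3)] →
      F (k + 4) = (wlift fib (G (k + 3)) ++ [Ltr.a]) ++
        [flipLetter (alph (k + 4)), alph (k + 4)] := by
    intro k h
    rw [F_succ, h, alph_succ (k + 3)]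
    cases alph (k + 3) <;> simp [flipLetter]
  induction k with
  | zero =>
    have h : F 3 = G 3 ++ [flipLetter (alph 3), alph 3] := by
      simp [F, G, wlift, fib, alph, flipLetter]
    exact ⟨h, hG _ _ _ _ (step 0 h)⟩
  | succ k ih =>
    have h := step k ih.1
    rw [← ih.2] at h
    exact ⟨h, hG _ _ _ _ (step (k + 1) h)⟩

theorem F_eq (k : ℕ) :
    F (k + 3) = G (k + 3) ++ [flipLetter (alph (k + 3)), alph (k + 3)] :=
  (F_eq_G_append k).1

theorem G_succ (k : ℕ) : G (k + 4) = wlift fib (G (k + 3)) ++ [Ltr.a] :=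
  (F_eq_G_append k).2

/-- Consecutive Fibonacci words commute up to their last two letters. -/
theorem F_append_F_succ (k : ℕ) :
    F (k + 1) ++ F (k + 2) = G (k + 3) ++ [alph (k + 3), flipLetter (alph (k + 3))] := by
  induction k with
  | zero => simp [F, G, wlift, fib, alph, flipLetter]
  | succ k ih =>
    have h := congrArg (wlift fib) ih
    rw [wlift_append, ← F_succ, ← F_succ] at h
    rw [h, G_succ, alph_succ (k + 3)]
    cases alph (k + 3) <;> simp [flipLetter]

theorem subsingleton_Occ_F (k : ℕ) :
    (Occ ([alph (k + 6)] ++ G (k + 3) ++ [alph (k + 6)]) (F (k + 6))).Subsingleton ∧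
      (Occ ([flipLetter (alph (k + 6))] ++ G (k + 4) ++ [flipLetter (alph (k + 6))])
        (F (k + 6))).Subsingleton := by
  induction k with
  | zero =>
    have hF : F 6 = [.a, .b, .a, .a, .b, .a, .b, .a] := rfl
    have h₁ : [alph 6] ++ G 3 ++ [alph 6] = [.a, .a] := rfl
    have h₂ : [flipLetter (alph 6)] ++ G 4 ++ [flipLetter (alph 6)] = [.b, .a, .b] := rfl
    have u₁ : Occ [.a, .a] (F 6) ⊆ {2} := by
      rintro i ⟨hi, h⟩
      simp only [hF] at hi h
      simp only [List.length_cons, List.length_nil] at hi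
      interval_cases i <;> simp_all
    have u₂ : Occ [.b, .a, .b] (F 6) ⊆ {4} := by
      rintro i ⟨hi, h⟩
      simp only [hF] at hi h
      simp only [List.length_cons, List.length_nil] at hi
      interval_cases i <;> simp_all
    simp only [Nat.zero_add, h₁, h₂]
    exact ⟨Set.subsingleton_singleton.anti u₁, Set.subsingleton_singleton.anti u₂⟩
  | succ k ih =>
    have h₁ := subsingleton_Occ_wlift_fib ih.1
    have h₂ := subsingleton_Occ_wlift_fib ih.2
    rw [← F_succ, ← G_succ, ← alph_succ] at h₁ h₂
    exact ⟨h₁, h₂⟩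

theorem mus_fib (i : ℕ) (hi : 6 ≤ i) :
    {u : List Ltr | IsMUS u (F i)} =
      { [alph i] ++ G (i - 3) ++ [alph i],
        [flipLetter (alph i)] ++ G (i - 2) ++ [flipLetter (alph i)] } := by
  obtain ⟨k, rfl⟩ := Nat.exists_eq_add_of_le' hi
  rw [show k + 6 - 3 = k + 3 by omega, show k + 6 - 2 = k + 4 by omega]
  obtain ⟨u₁, u₂⟩ := subsingleton_Occ_F k
  have e₆ : F (k + 6) = F (k + 5) ++ F (k + 4) := F_add_three _
  have e₅ : F (k + 5) = F (k + 4) ++ F (k + 3) := F_add_three _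
  have g₃ := F_eq k
  have g₄ : F (k + 4) = G (k + 4) ++ [flipLetter (alph (k + 4)), alph (k + 4)] := F_eq (k + 1)
  have g₅ : F (k + 5) = G (k + 5) ++ [flipLetter (alph (k + 5)), alph (k + 5)] := F_eq (k + 2)
  have c₅ : F (k + 3) ++ F (k + 4) = G (k + 5) ++ [alph (k + 5), flipLetter (alph (k + 5))] :=
    F_append_F_succ (k + 2)
  simp only [alph_succ, flipLetter_flipLetter] at g₃ g₄ g₅ c₅ u₁ u₂ ⊢
  have l₃ := congrArg List.length g₃
  have l₄ := congrArg List.length g₄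
  have l₅ := congrArg List.length g₅
  have l₅' := congrArg List.length e₅
  simp only [List.length_append, List.length_cons, List.length_nil] at l₃ l₄ l₅ l₅'
  refine setOf_isMUS_eq_pair (f := (F (k + 4)).length) (g := (F (k + 5)).length) (by omega)
    (by omega) (by rw [e₆, List.length_append, Nat.add_comm]) ?_ ?_ ?_ ?_ u₁ ?_ ?_ u₂
  · intro j hj
    rw [e₆, List.getElem?_append_left (by omega)]
    conv_rhs => rw [e₅, List.append_assoc, c₅, List.getElem?_append_right (by omega)]
    rw [g₅, List.getElem?_append_left (by omega), Nat.add_sub_cancel,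
      List.getElem?_append_left (by omega)]
  · intro j hj
    conv_rhs => rw [e₆, List.getElem?_append_right (by omega)]
    rw [e₆, e₅, List.append_assoc, List.getElem?_append_left hj, Nat.add_sub_cancel]
  · refine mem_Occ_iff_exists_append.2
      ⟨G (k + 4) ++ [flipLetter (alph k)], [flipLetter (alph k)] ++ F (k + 4), ?_, ?_⟩
    · rw [e₆, e₅]
      conv_lhs => rw [List.append_assoc, g₃]
      nth_rw 1 [g₄]
      simp
    · simp; omega
  · simp; omega
  · refine mem_Occ_iff_exists_append.2 ⟨G (k + 5) ++ [alph k], [alph k], ?_, ?_⟩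
    · rw [e₆, g₅, g₄]
      simp
    · simp; omega
  · simp; omega
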